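/- If [i_1,…,i_N] is a stepping sequence for m, then the reversed list [i_N,…,i_1] is also a stepping sequence for m. -/

import Mathlib

open List

/-- The initial configuration `(1, 2, …, m)`. -/
def initConfig (m : ℕ) : List ℕ := (List.range m).map (· + 1)

/-- A move at index `i` (with `1 ≤ i ≤ m-1`) transposes the entries `q_i` and `q_{i+1}`
(one-indexed), i.e. the entries at zero-indexed positions `i-1` and `i`. -/
def swapAdj (q : List ℕ) (i : ℕ) : List ℕ :=
  (q.set (i - 1) (q.getD i 0)).set i (q.getD (i - 1) 0)

/-- The prefix set `S_k(q) = {q_1, …, q_k}`. -/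
def prefixSet (q : List ℕ) (k : ℕ) : Finset ℕ := (q.take k).toFinset

/-- The initial prefix sets `S_0 ⊂ S_1 ⊂ … ⊂ S_m` of the configuration `(1,…,m)`. -/
def initSets (m : ℕ) : List (Finset ℕ) :=
  (List.range (m + 1)).map (fun k => prefixSet (initConfig m) k)

/-- The sets generated by applying a sequence of moves starting from configuration `q`:
the `t`-th generated set is the prefix set of length `i_t` of the configuration
obtained after the `t`-th move. -/
def genSetsAux (q : List ℕ) : List ℕ → List (Finset ℕ)
  | [] => []
  | i :: rest => prefixSet (swapAdj q i) i :: genSetsAux (swapAdj q i) rest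

/-- The sets generated by the moves, starting from the initial configuration `(1,…,m)`. -/
def genSets (m : ℕ) (moves : List ℕ) : List (Finset ℕ) :=
  genSetsAux (initConfig m) moves

/-- `moves` is a stepping sequence for `m`: each move index lies in `{1,…,m-1}`, and the
initial prefix sets `S_0,…,S_m` together with the generated sets list every subset of
`{1,…,m}` exactly once. -/
def IsSteppingSeq (m : ℕ) (moves : List ℕ) : Prop :=
  (∀ i ∈ moves, 1 ≤ i ∧ i ≤ m - 1) ∧
  (initSets m ++ genSets m moves).Perm (Finset.Icc 1 m).powerset.toList

theorem exists_append_of_move {q : List ℕ} {i : ℕ} (h1 : 1 ≤ i) (h2 : i < q.length) :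
    ∃ a x y b, q = a ++ x :: y :: b ∧ i = a.length + 1 := by
  refine ⟨q.take (i - 1), q[i - 1], q[i], q.drop (i + 1), ?_, by simp; omega⟩
  conv_lhs => rw [← List.take_append_drop (i - 1) q]
  rw [List.drop_eq_getElem_cons (by omega)]
  have h : i - 1 + 1 = i := by omega
  simp only [h]
  rw [← List.drop_eq_getElem_cons h2]

theorem swapAdj_append (a b : List ℕ) (x y : ℕ) :
    swapAdj (a ++ x :: y :: b) (a.length + 1) = a ++ y :: x :: b := by
  simp [swapAdj]

theorem length_swapAdj (q : List ℕ) (i : ℕ) : (swapAdj q i).length = q.length := by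
  simp [swapAdj]

theorem swapAdj_swapAdj {q : List ℕ} {i : ℕ} (h1 : 1 ≤ i) (h2 : i < q.length) :
    swapAdj (swapAdj q i) i = q := by
  obtain ⟨a, x, y, b, rfl, rfl⟩ := exists_append_of_move h1 h2
  rw [swapAdj_append, swapAdj_append]

theorem swapAdj_perm {q : List ℕ} {i : ℕ} (h1 : 1 ≤ i) (h2 : i < q.length) :
    (swapAdj q i).Perm q := by
  obtain ⟨a, x, y, b, rfl, rfl⟩ := exists_append_of_move h1 h2
  rw [swapAdj_append]
  exact (List.Perm.swap x y b).append_left a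

theorem swapAdj_map (f : ℕ → ℕ) {q : List ℕ} {i : ℕ} (h1 : 1 ≤ i) (h2 : i < q.length) :
    swapAdj (q.map f) i = (swapAdj q i).map f := by
  obtain ⟨a, x, y, b, rfl, rfl⟩ := exists_append_of_move h1 h2
  rw [swapAdj_append]
  simpa using swapAdj_append (a.map f) (b.map f) (f x) (f y)

/-- A move at index `i` changes only the prefix set of length `i`. -/
theorem prefixSet_swapAdj_of_ne {q : List ℕ} {i k : ℕ} (h1 : 1 ≤ i) (h2 : i < q.length)
    (hk : k ≠ i) : prefixSet (swapAdj q i) k = prefixSet q k := by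
  obtain ⟨a, x, y, b, rfl, rfl⟩ := exists_append_of_move h1 h2
  rw [swapAdj_append, prefixSet, prefixSet, List.take_append, List.take_append]
  obtain h | ⟨j, h⟩ : k - a.length = 0 ∨ ∃ j, k - a.length = j + 2 := by
    rcases Nat.lt_or_ge a.length k with h | h
    · exact .inr ⟨k - a.length - 2, by omega⟩
    · exact .inl (by omega)
  · simp [h]
  · ext z
    simp [h]
    tauto

theorem prefixSet_map (f : ℕ → ℕ) (q : List ℕ) (k : ℕ) :
    prefixSet (q.map f) k = (prefixSet q k).image f := by
  ext z
  simp [prefixSet, ← List.map_take]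

theorem prefixSet_subset (q : List ℕ) (k : ℕ) : prefixSet q k ⊆ q.toFinset := by
  intro z hz
  simp only [prefixSet, List.mem_toFinset] at hz ⊢
  exact List.mem_of_mem_take hz

theorem genSetsAux_map (f : ℕ → ℕ) {q G : List ℕ} (hG : ∀ i ∈ G, 1 ≤ i ∧ i < q.length) :
    genSetsAux (q.map f) G = (genSetsAux q G).map (Finset.image f) := by
  induction G generalizing q with
  | nil => rfl
  | cons i r ih =>
    have hi := hG i (by simp)
    simp only [genSetsAux, swapAdj_map f hi.1 hi.2, prefixSet_map, List.map_cons]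
    rw [ih fun j hj => by rw [length_swapAdj]; exact hG j (by simp [hj])]

theorem subset_of_mem_genSetsAux {q G : List ℕ} (hG : ∀ i ∈ G, 1 ≤ i ∧ i < q.length)
    {s : Finset ℕ} (hs : s ∈ genSetsAux q G) : s ⊆ q.toFinset := by
  induction G generalizing q with
  | nil => simp [genSetsAux] at hs
  | cons i r ih =>
    have hi := hG i (by simp)
    rw [← List.toFinset_eq_of_perm _ _ (swapAdj_perm hi.1 hi.2)]
    rcases List.mem_cons.mp hs with rfl | hs
    · exact prefixSet_subset _ _
    · exact ih (fun j hj => by rw [length_swapAdj]; exact hG j (by simp [hj])) hs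

theorem genSetsAux_append (q G H : List ℕ) :
    genSetsAux q (G ++ H) = genSetsAux q G ++ genSetsAux (G.foldl swapAdj q) H := by
  induction G generalizing q with
  | nil => rfl
  | cons i r ih => simp [genSetsAux, ih]

theorem length_genSetsAux (q G : List ℕ) : (genSetsAux q G).length = G.length := by
  induction G generalizing q with
  | nil => rfl
  | cons i r ih => simp [genSetsAux, ih]

theorem length_foldl_swapAdj (q G : List ℕ) : (G.foldl swapAdj q).length = q.length := by
  induction G generalizing q with
  | nil => rfl
  | cons i r ih => rw [List.foldl_cons, ih, length_swapAdj]

theorem foldl_swapAdj_reverse {q G : List ℕ} (hG : ∀ i ∈ G, 1 ≤ i ∧ i < q.length) :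
    G.reverse.foldl swapAdj (G.foldl swapAdj q) = q := by
  induction G generalizing q with
  | nil => rfl
  | cons i r ih =>
    have hi := hG i (by simp)
    rw [List.foldl_cons, List.reverse_cons, List.foldl_append,
      ih fun j hj => by rw [length_swapAdj]; exact hG j (by simp [hj])]
    exact swapAdj_swapAdj hi.1 hi.2

theorem List.Nodup.cons_map_perm_cons_map {α β : Type*} [DecidableEq α] {l : List α}
    (hl : l.Nodup) {i : α} (hi : i ∈ l) {f g : α → β} (hfg : ∀ k, k ≠ i → f k = g k) :
    (f i :: l.map g).Perm (g i :: l.map f) := by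
  have hp := List.perm_cons_erase hi
  have he : (l.erase i).map g = (l.erase i).map f :=
    List.map_congr_left fun k hk => (hfg k (hl.mem_erase_iff.mp hk).1).symm
  refine ((hp.map g).cons (f i)).trans (.trans ?_ ((hp.map f).cons (g i)).symm)
  rw [List.map_cons, List.map_cons, he]
  exact List.Perm.swap _ _ _

/-- Running the moves backwards from the final configuration lists the same sets, each the same
number of times. -/
theorem prefixSets_append_genSetsAux_perm {q G : List ℕ}
    (hG : ∀ i ∈ G, 1 ≤ i ∧ i < q.length) :
    ((List.range (q.length + 1)).map (prefixSet q) ++ genSetsAux q G).Perm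
      ((List.range (q.length + 1)).map (prefixSet (G.foldl swapAdj q)) ++
        genSetsAux (G.foldl swapAdj q) G.reverse) := by
  induction G generalizing q with
  | nil => rfl
  | cons i r ih =>
    have hi := hG i (by simp)
    have hr : ∀ j ∈ r, 1 ≤ j ∧ j < (swapAdj q i).length := fun j hj => by
      rw [length_swapAdj]; exact hG j (by simp [hj])
    have ih := ih hr
    rw [length_swapAdj] at ih
    rw [List.foldl_cons, List.reverse_cons, genSetsAux_append, foldl_swapAdj_reverse hr]
    simp only [genSetsAux, swapAdj_swapAdj hi.1 hi.2]
    rw [← List.append_assoc]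
    refine List.perm_middle.trans (.trans ?_ (ih.append_right [prefixSet q i]))
    refine .trans ?_ (List.perm_append_singleton _ _).symm
    exact (List.nodup_range.cons_map_perm_cons_map (i := i) (by simp; omega)
      fun k hk => prefixSet_swapAdj_of_ne hi.1 hi.2 hk).append_right _

theorem length_initConfig (m : ℕ) : (initConfig m).length = m := by simp [initConfig]

theorem toFinset_initConfig (m : ℕ) : (initConfig m).toFinset = Finset.Icc 1 m := by
  ext z
  simp only [initConfig, List.mem_toFinset, List.mem_map, List.mem_range, Finset.mem_Icc]
  exact ⟨by rintro ⟨a, h, rfl⟩; omega, fun h => ⟨z - 1, by omega, by omega⟩⟩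

theorem exists_map_initConfig_eq (q : List ℕ) : ∃ f, (initConfig q.length).map f = q := by
  refine ⟨fun k => q.getD (k - 1) 0, List.ext_getElem (by simp [initConfig]) fun k h _ => ?_⟩
  have hk : k < q.length := by simpa [initConfig] using h
  simp [initConfig, hk]

/-- If `[i₁,…,i_N]` is a stepping sequence for `m`, then so is its reverse
`[i_N,…,i₁]`. -/
theorem reverse_isSteppingSeq (m : ℕ) (hm : 2 ≤ m) (G : List ℕ)
    (hG : IsSteppingSeq m G) : IsSteppingSeq m G.reverse := by
  obtain ⟨hmem, hperm⟩ := hG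
  have hlt : ∀ i ∈ G, 1 ≤ i ∧ i < (initConfig m).length := fun i hi => by
    rw [length_initConfig]; have := hmem i hi; omega
  have hrev : ∀ i ∈ G.reverse, 1 ≤ i ∧ i < (initConfig m).length := fun i hi =>
    hlt i (List.mem_reverse.mp hi)
  refine ⟨fun i hi => hmem i (List.mem_reverse.mp hi), ?_⟩
  obtain ⟨f, hf⟩ := exists_map_initConfig_eq (G.foldl swapAdj (initConfig m))
  rw [length_foldl_swapAdj, length_initConfig] at hf
  have hback := prefixSets_append_genSetsAux_perm hlt
  rw [← hf, genSetsAux_map f hrev, length_initConfig] at hback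
  have hmap : ((List.range (m + 1)).map (prefixSet ((initConfig m).map f)) ++
      (genSetsAux (initConfig m) G.reverse).map (Finset.image f)) =
      (initSets m ++ genSets m G.reverse).map (Finset.image f) := by
    simp [initSets, genSets, prefixSet_map]
  rw [hmap] at hback
  have hnodup : (initSets m ++ genSets m G.reverse).Nodup :=
    ((hback.symm.trans hperm).nodup_iff.mpr (Finset.nodup_toList _)).of_map
  refine (List.subperm_of_subset hnodup fun s hs => ?_).perm_of_length_le ?_
  · rw [Finset.mem_toList, Finset.mem_powerset, ← toFinset_initConfig]
    rcases List.mem_append.mp hs with hs | hs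
    · obtain ⟨k, -, rfl⟩ := List.mem_map.mp hs
      exact prefixSet_subset _ _
    · exact subset_of_mem_genSetsAux hrev hs
  · rw [← hperm.length_eq]
    simp [genSets, length_genSetsAux]
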